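/- arXiv:2505.12117 — 5 statements merged into one kernel-verified Lean document; each statement's English description precedes it below -/
import Mathlib

section
/- Let S and Σ be real symmetric positive definite n×n matrices. Then log det Σ + Tr(Σ⁻¹ S) ≥ log det S + n, with equality if and only if Σ = S. Consequently, S is the unique minimizer over positive definite matrices of the map Σ ↦ log det Σ + Tr(Σ⁻¹ S). -/
open Matrix

namespace Matrix

variable {m : Type*} [Fintype m] [DecidableEq m]

theorem IsHermitian.eq_one_of_eigenvalues_eq_one {M : Matrix m m ℝ} (hM : M.IsHermitian)
    (h : ∀ i, hM.eigenvalues i = 1) : M = 1 := by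
  have h_diag : diagonal ((RCLike.ofReal : ℝ → ℝ) ∘ hM.eigenvalues) = 1 := by
    rw [← diagonal_one]
    congr 1
    ext i
    simp [h i]
  rw [hM.spectral_theorem, h_diag, map_one]

/-- Among positive definite matrices, `log det M ≤ Tr M - n` is strict unless `M = 1`. -/
theorem PosDef.log_det_lt_trace_sub_card {M : Matrix m m ℝ} (hM : M.PosDef) (hne : M ≠ 1) :
    Real.log M.det < M.trace - Fintype.card m := by
  obtain ⟨i, hi⟩ : ∃ i, hM.1.eigenvalues i ≠ 1 := by
    contrapose! hne
    exact hM.1.eq_one_of_eigenvalues_eq_one hne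
  calc Real.log M.det = ∑ i, Real.log (hM.1.eigenvalues i) := by
        rw [hM.1.det_eq_prod_eigenvalues]
        exact Real.log_prod fun i _ ↦ (hM.eigenvalues_pos i).ne'
    _ < ∑ i, (hM.1.eigenvalues i - 1) :=
        Finset.sum_lt_sum (fun i _ ↦ Real.log_le_sub_one_of_pos (hM.eigenvalues_pos i))
          ⟨i, Finset.mem_univ i, Real.log_lt_sub_one_of_pos (hM.eigenvalues_pos i) hi⟩
    _ = M.trace - Fintype.card m := by
        simp [hM.1.trace_eq_sum_eigenvalues]

open scoped MatrixOrder in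
/-- Every positive definite matrix `A` has an invertible factor `B` with `A⁻¹ = Bᴴ * B`. -/
theorem PosDef.exists_isUnit_inv_eq_conjTranspose_mul_self {A : Matrix m m ℝ} (hA : A.PosDef) :
    ∃ B : Matrix m m ℝ, IsUnit B ∧ A⁻¹ = Bᴴ * B := by
  obtain ⟨B, hB⟩ := CStarAlgebra.nonneg_iff_eq_star_mul_self.mp hA.inv.posSemidef.nonneg
  refine ⟨B, ?_, hB⟩
  have h_unit := hA.inv.isUnit
  rw [hB, isUnit_iff_isUnit_det, det_mul] at h_unit
  exact (isUnit_iff_isUnit_det B).mpr (isUnit_of_mul_isUnit_right h_unit)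

theorem PosDef.log_det_add_card_lt {S A : Matrix m m ℝ} (hS : S.PosDef) (hA : A.PosDef)
    (hne : A ≠ S) :
    Real.log S.det + Fintype.card m < Real.log A.det + (A⁻¹ * S).trace := by
  obtain ⟨B, hB, hAB⟩ := hA.exists_isUnit_inv_eq_conjTranspose_mul_self
  have hM : (B * S * Bᴴ).PosDef :=
    hS.mul_mul_conjTranspose_same (vecMul_injective_iff_isUnit.mpr hB)
  have h_trace : (B * S * Bᴴ).trace = (A⁻¹ * S).trace := by
    rw [hAB, trace_mul_comm, ← mul_assoc]
  have h_det : (B * S * Bᴴ).det = A.det⁻¹ * S.det := by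
    have h_inv := congrArg det hAB
    rw [det_nonsing_inv, Ring.inverse_eq_inv', det_mul] at h_inv
    rw [h_inv, det_mul, det_mul]
    ring
  have h_ne : B * S * Bᴴ ≠ 1 := by
    intro h
    apply hne
    have h_right : Bᴴ * (B * S) = 1 := mul_eq_one_comm.mp h
    rw [← mul_assoc, ← hAB] at h_right
    have hA_det := (isUnit_iff_isUnit_det A).mp hA.isUnit
    calc A = A * (A⁻¹ * S) := by rw [h_right, mul_one]
      _ = S := mul_nonsing_inv_cancel_left _ _ hA_det
  have h_lt := hM.log_det_lt_trace_sub_card h_ne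
  rw [h_trace, h_det, Real.log_mul (inv_ne_zero hA.det_pos.ne') hS.det_pos.ne',
    Real.log_inv] at h_lt
  linarith

theorem PosDef.trace_inv_mul_self {S : Matrix m m ℝ} (hS : S.PosDef) :
    (S⁻¹ * S).trace = Fintype.card m := by
  rw [nonsing_inv_mul _ ((isUnit_iff_isUnit_det S).mp hS.isUnit), trace_one]

end Matrix

theorem stmt_5 (n : ℕ) (S Sig : Matrix (Fin n) (Fin n) ℝ)
    (hS : S.PosDef) (hSig : Sig.PosDef) :
    (Real.log S.det + n ≤ Real.log Sig.det + (Sig⁻¹ * S).trace) ∧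
    (Real.log Sig.det + (Sig⁻¹ * S).trace = Real.log S.det + n ↔ Sig = S) ∧
    (∀ Sig' : Matrix (Fin n) (Fin n) ℝ, Sig'.PosDef → Sig' ≠ S →
      Real.log S.det + (S⁻¹ * S).trace < Real.log Sig'.det + (Sig'⁻¹ * S).trace) := by
  have h_trace : (S⁻¹ * S).trace = n := by simpa using hS.trace_inv_mul_self
  have h_lt : ∀ A : Matrix (Fin n) (Fin n) ℝ, A.PosDef → A ≠ S →
      Real.log S.det + n < Real.log A.det + (A⁻¹ * S).trace := fun A hA hne ↦ by
    simpa using hS.log_det_add_card_lt hA hne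
  refine ⟨?_, ⟨fun h ↦ ?_, ?_⟩, ?_⟩
  · rcases eq_or_ne Sig S with rfl | hne
    · rw [h_trace]
    · exact (h_lt Sig hSig hne).le
  · by_contra hne
    exact (h_lt Sig hSig hne).ne' h
  · rintro rfl
    rw [h_trace]
  · rwa [h_trace]
end

section
/- Let n ≥ 1, let Σ_k be a real symmetric positive definite n×n matrix, and let x₁, …, x_m ∈ ℝⁿ be nonzero vectors whose linear span is all of ℝⁿ. Define Ŝ = (n/m) ∑_{i=1}^m (1 / (x_iᵀ Σ_k⁻¹ x_i)) x_i x_iᵀ. Then Ŝ is symmetric positive definite, and for every symmetric positive definite n×n matrix Σ with Σ ≠ Ŝ one has log det Ŝ + Tr(Ŝ⁻¹ Ŝ) < log det Σ + Tr(Σ⁻¹ Ŝ). Hence the unique minimizer of the EM surrogate Σ ↦ log det Σ + Tr(Σ⁻¹ Ŝ) over positive definite matrices is exactly the Tyler fixed-point update Σ_{k+1} = (n/m) ∑_{i=1}^m (1 / (x_iᵀ Σ_k⁻¹ x_i)) x_i x_iᵀ; that is, the EM update for the angular central Gaussian likelihood coincides with Tyler's fixed-point iteration. -/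
open Matrix

namespace Matrix

/-- A positive definite matrix other than the identity satisfies the strict form of
`log det A ≤ tr A - n`. -/
lemma PosDef.card_add_log_det_lt_trace {ι : Type*} [Fintype ι] [DecidableEq ι]
    {A : Matrix ι ι ℝ} (hA : A.PosDef) (hne : A ≠ 1) :
    (Fintype.card ι : ℝ) + Real.log A.det < A.trace := by
  have hdet : A.det = ∏ i, hA.1.eigenvalues i := by
    simpa using hA.1.det_eq_prod_eigenvalues
  have htr : A.trace = ∑ i, hA.1.eigenvalues i := by
    simpa using hA.1.trace_eq_sum_eigenvalues
  obtain ⟨j, hj⟩ : ∃ j, hA.1.eigenvalues j ≠ 1 := by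
    by_contra! h
    apply hne
    have hdiag : diagonal (RCLike.ofReal ∘ hA.1.eigenvalues) = (1 : Matrix ι ι ℝ) := by
      rw [← diagonal_one]
      congr 1
      funext i
      simp [h i]
    have hspec := hA.1.spectral_theorem
    rwa [hdiag, map_one] at hspec
  rw [hdet, htr, Real.log_prod fun i _ => (hA.eigenvalues_pos i).ne']
  have hlt : ∑ i, (1 + Real.log (hA.1.eigenvalues i)) < ∑ i, hA.1.eigenvalues i := by
    refine Finset.sum_lt_sum (fun i _ => ?_) ⟨j, Finset.mem_univ j, ?_⟩
    · linarith [Real.log_le_sub_one_of_pos (hA.eigenvalues_pos i)]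
    · linarith [Real.log_lt_sub_one_of_pos (hA.eigenvalues_pos j) hj]
  simpa [Finset.sum_add_distrib] using hlt

open scoped MatrixOrder Matrix.Norms.L2Operator in
/-- The Gaussian surrogate `Σ ↦ log det Σ + tr (Σ⁻¹ S)` is uniquely minimized at `S`. -/
lemma PosDef.log_det_add_trace_lt {ι : Type*} [Fintype ι] [DecidableEq ι]
    {S T : Matrix ι ι ℝ} (hS : S.PosDef) (hT : T.PosDef) (hne : T ≠ S) :
    Real.log S.det + (S⁻¹ * S).trace < Real.log T.det + (T⁻¹ * S).trace := by
  obtain ⟨Y, hY⟩ : ∃ Y : Matrix ι ι ℝ, S = Yᴴ * Y :=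
    CStarAlgebra.nonneg_iff_eq_star_mul_self.mp hS.posSemidef.nonneg
  have hSdet : 0 < S.det := hS.det_pos
  have hTdet : 0 < T.det := hT.det_pos
  have hYdet : IsUnit Y.det := by
    rw [isUnit_iff_ne_zero]
    intro h
    rw [hY, det_mul, h, mul_zero] at hSdet
    exact hSdet.false
  have hYHdet : IsUnit Yᴴ.det := by simpa [det_conjTranspose] using hYdet
  have hYinj : Function.Injective Y.vecMul :=
    vecMul_injective_iff_isUnit.mpr ((isUnit_iff_isUnit_det Y).mpr hYdet)
  have hA : (Y * T⁻¹ * Yᴴ).PosDef := hT.inv.mul_mul_conjTranspose_same hYinj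
  have hA1 : Y * T⁻¹ * Yᴴ ≠ 1 := by
    intro h
    apply hne
    have hTinv : T⁻¹ = Y⁻¹ * Yᴴ⁻¹ := by
      calc T⁻¹ = Y⁻¹ * (Y * T⁻¹ * Yᴴ) * Yᴴ⁻¹ := by
            rw [mul_assoc Y, nonsing_inv_mul_cancel_left _ _ hYdet,
              mul_nonsing_inv_cancel_right _ _ hYHdet]
        _ = Y⁻¹ * Yᴴ⁻¹ := by rw [h, mul_one]
    rw [← mul_inv_rev, ← hY] at hTinv
    exact inv_inj hTinv hTdet.ne'.isUnit
  have hmain := hA.card_add_log_det_lt_trace hA1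
  have htr : (Y * T⁻¹ * Yᴴ).trace = (T⁻¹ * S).trace := by
    rw [hY, mul_assoc, trace_mul_comm, mul_assoc]
  have hdet : (Y * T⁻¹ * Yᴴ).det = T.det⁻¹ * S.det := by
    rw [hY, det_mul, det_mul, det_mul, det_nonsing_inv, Ring.inverse_eq_inv']
    ring
  rw [htr, hdet, Real.log_mul (inv_ne_zero hTdet.ne') hSdet.ne', Real.log_inv] at hmain
  rw [nonsing_inv_mul _ hSdet.ne'.isUnit, trace_one]
  linarith

/-- A positively weighted sum of the rank-one matrices of a spanning family is positive definite. -/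
lemma posDef_sum_smul_vecMulVec_of_span_eq_top {ι κ : Type*} [Fintype ι] [Fintype κ]
    {x : κ → ι → ℝ} (hspan : Submodule.span ℝ (Set.range x) = ⊤)
    {w : κ → ℝ} (hw : ∀ i, 0 < w i) :
    (∑ i, w i • vecMulVec (x i) (x i)).PosDef := by
  refine .of_dotProduct_mulVec_pos ?_ fun v hv => ?_
  · ext a b
    simp [sum_apply, vecMulVec_apply, mul_comm]
  · have hquad : star v ⬝ᵥ ((∑ i, w i • vecMulVec (x i) (x i)) *ᵥ v) =
        ∑ i, w i * (x i ⬝ᵥ v) ^ 2 := by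
      rw [sum_mulVec, dotProduct_sum]
      refine Finset.sum_congr rfl fun i _ => ?_
      simp only [star_trivial, smul_mulVec, vecMulVec_mulVec, dotProduct_smul, smul_eq_mul,
        op_smul_eq_smul, dotProduct_comm v (x i)]
      ring
    obtain ⟨j, hj⟩ : ∃ j, x j ⬝ᵥ v ≠ 0 := by
      by_contra! h
      have hall : ∀ u ∈ Submodule.span ℝ (Set.range x), u ⬝ᵥ v = 0 := by
        intro u hu
        induction hu using Submodule.span_induction with
        | mem u hu => obtain ⟨i, rfl⟩ := hu; exact h i
        | zero => exact zero_dotProduct v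
        | add a b _ _ ha hb => rw [add_dotProduct, ha, hb, add_zero]
        | smul c a _ ha => rw [smul_dotProduct, ha, smul_zero]
      exact hv (dotProduct_self_eq_zero.mp (hall v (hspan ▸ Submodule.mem_top)))
    rw [hquad]
    exact Finset.sum_pos' (fun i _ => mul_nonneg (hw i).le (sq_nonneg _))
      ⟨j, Finset.mem_univ j, mul_pos (hw j) (by positivity)⟩

end Matrix

theorem stmt_6 (n m : ℕ) (hn : 1 ≤ n) (hm : 1 ≤ m)
    (Sigk : Matrix (Fin n) (Fin n) ℝ) (hSigk : Sigk.PosDef)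
    (x : Fin m → Fin n → ℝ) (hx : ∀ i, x i ≠ 0)
    (hspan : Submodule.span ℝ (Set.range x) = ⊤)
    (Shat : Matrix (Fin n) (Fin n) ℝ)
    (hShat : Shat = ((n : ℝ) / m) •
      ∑ i : Fin m, (1 / (x i ⬝ᵥ (Sigk⁻¹ *ᵥ x i))) • vecMulVec (x i) (x i)) :
    Shat.PosDef ∧
    ∀ Sig : Matrix (Fin n) (Fin n) ℝ, Sig.PosDef → Sig ≠ Shat →
      Real.log Shat.det + (Shat⁻¹ * Shat).trace <
        Real.log Sig.det + (Sig⁻¹ * Shat).trace := by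
  have hw : ∀ i, 0 < 1 / (x i ⬝ᵥ (Sigk⁻¹ *ᵥ x i)) := fun i =>
    one_div_pos.mpr (by simpa using hSigk.inv.dotProduct_mulVec_pos (hx i))
  have hc : (0 : ℝ) < n / m := div_pos (by exact_mod_cast hn) (by exact_mod_cast hm)
  have hpos : Shat.PosDef :=
    hShat ▸ (posDef_sum_smul_vecMulVec_of_span_eq_top hspan hw).smul hc
  exact ⟨hpos, fun Sig hSig hne => hpos.log_det_add_trace_lt hSig hne⟩
end

section
/- Let n ≥ 1, let x₁, …, x_m ∈ ℝⁿ be nonzero vectors, and let Σ* be a real symmetric positive definite n×n matrix. Then Σ* satisfies the fixed-point equation Σ* = (n/m) ∑_{i=1}^m (1 / (x_iᵀ (Σ*)⁻¹ x_i)) x_i x_iᵀ if and only if for every real symmetric n×n matrix H, the derivative at t = 0 of the function t ↦ log det(Σ* + tH) + (n/m) ∑_{i=1}^m log(x_iᵀ (Σ* + tH)⁻¹ x_i) is zero. -/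
open Matrix

theorem hasDerivAt_ringInverse_add_smul {R : Type*} [NormedRing R] [HasSummableGeomSeries R]
    [NormedAlgebra ℝ R] (u : Rˣ) (h : R) :
    HasDerivAt (fun t : ℝ => Ring.inverse ((u : R) + t • h)) (-(↑u⁻¹ * h * ↑u⁻¹)) 0 := by
  have hline : HasDerivAt (fun t : ℝ => (u : R) + t • h) h 0 :=
    (((hasDerivAt_id (0 : ℝ)).smul_const h).const_add (u : R)).congr_deriv (one_smul ℝ h)
  exact (hasFDerivAt_ringInverse (𝕜 := ℝ) u).comp_hasDerivAt_of_eq 0 hline (by simp)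

section MatrixCalculus

variable {ι : Type*} [Fintype ι] [DecidableEq ι]

theorem hasDerivAt_det_one_add_smul (M : Matrix ι ι ℝ) :
    HasDerivAt (fun t : ℝ => (1 + t • M).det) M.trace 0 := by
  rw [funext fun t : ℝ => det_one_add_smul t M]
  have h := (((hasDerivAt_id (0 : ℝ)).const_mul M.trace).const_add 1).add
    (((1 + (Polynomial.X : Polynomial ℝ) • M.map Polynomial.C).det.divX.divX.hasDerivAt 0).mul
      ((hasDerivAt_id (0 : ℝ)).pow 2))
  simpa using! h

theorem hasDerivAt_log_det_add_smul {S : Matrix ι ι ℝ} (hS : IsUnit S.det) (H : Matrix ι ι ℝ) :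
    HasDerivAt (fun t : ℝ => Real.log (S + t • H).det) (S⁻¹ * H).trace 0 := by
  have hdet : ∀ t : ℝ, (S + t • H).det = S.det * (1 + t • (S⁻¹ * H)).det := fun t => by
    rw [← det_mul, mul_add, mul_one, Matrix.mul_smul, mul_nonsing_inv_cancel_left _ _ hS]
  simp_rw [hdet]
  have h := ((hasDerivAt_det_one_add_smul (S⁻¹ * H)).const_mul S.det).log (by simpa using hS.ne_zero)
  simpa [mul_div_cancel_left₀ _ hS.ne_zero] using h

attribute [local instance] Matrix.linftyOpNormedRing Matrix.linftyOpNormedAlgebra in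
theorem hasDerivAt_dotProduct_inv_add_smul_mulVec {S : Matrix ι ι ℝ} (hS : IsUnit S)
    (H : Matrix ι ι ℝ) (x y : ι → ℝ) :
    HasDerivAt (fun t : ℝ => x ⬝ᵥ ((S + t • H)⁻¹ *ᵥ y))
      (-(x ⬝ᵥ ((S⁻¹ * H * S⁻¹) *ᵥ y))) 0 := by
  obtain ⟨u, rfl⟩ := hS
  let L : Matrix ι ι ℝ →ₗ[ℝ] ℝ :=
    { toFun := fun M => x ⬝ᵥ (M *ᵥ y)
      map_add' := fun M N => by rw [add_mulVec, dotProduct_add]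
      map_smul' := fun r M => by rw [smul_mulVec, dotProduct_smul]; rfl }
  have h := L.toContinuousLinearMap.hasFDerivAt.comp_hasDerivAt 0
    (hasDerivAt_ringInverse_add_smul u H)
  have hderiv : L (-((↑u⁻¹ : Matrix ι ι ℝ) * H * (↑u⁻¹ : Matrix ι ι ℝ))) =
      -(x ⬝ᵥ (((u : Matrix ι ι ℝ)⁻¹ * H * (u : Matrix ι ι ℝ)⁻¹) *ᵥ y)) := by
    rw [map_neg, coe_units_inv]
    rfl
  rw [← hderiv]
  simp_rw [nonsing_inv_eq_ringInverse]
  exact h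

end MatrixCalculus

theorem trace_mul_vecMulVec_mul_mul {ι : Type*} [Fintype ι] (A H : Matrix ι ι ℝ) (x : ι → ℝ) :
    (A * vecMulVec x x * A * H).trace = x ⬝ᵥ ((A * H * A) *ᵥ x) := by
  rw [mul_assoc, mul_assoc, trace_mul_comm, mul_assoc, mul_assoc, vecMulVec_mul, trace_vecMulVec,
    dotProduct_comm, ← dotProduct_mulVec]

theorem hasDerivAt_tyler_objective {ι κ : Type*} [Fintype ι] [DecidableEq ι] [Fintype κ]
    {S : Matrix ι ι ℝ} (hS : S.PosDef) {x : κ → ι → ℝ} (hx : ∀ i, x i ≠ 0) (c : ℝ)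
    (H : Matrix ι ι ℝ) :
    HasDerivAt (fun t : ℝ => Real.log (S + t • H).det +
        c * ∑ i, Real.log (x i ⬝ᵥ ((S + t • H)⁻¹ *ᵥ x i)))
      (S⁻¹ * (S - c • ∑ i, (1 / (x i ⬝ᵥ (S⁻¹ *ᵥ x i))) • vecMulVec (x i) (x i)) * S⁻¹ * H).trace
      0 := by
  have hdet : IsUnit S.det := (isUnit_iff_isUnit_det S).mp hS.isUnit
  have hq : ∀ i, x i ⬝ᵥ (S⁻¹ *ᵥ x i) ≠ 0 := fun i => by
    simpa using (hS.inv.dotProduct_mulVec_pos (hx i)).ne'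
  have h := (hasDerivAt_log_det_add_smul hdet H).add
    ((HasDerivAt.fun_sum (u := Finset.univ) fun i _ =>
      (hasDerivAt_dotProduct_inv_add_smul_mulVec hS.isUnit H (x i) (x i)).log
        (by simpa using hq i)).const_mul c)
  refine h.congr_deriv ?_
  simp only [mul_sub, sub_mul, trace_sub, nonsing_inv_mul _ hdet, one_mul, Matrix.mul_smul,
    Matrix.smul_mul, Matrix.mul_sum, Matrix.sum_mul, trace_smul, trace_sum,
    trace_mul_vecMulVec_mul_mul, zero_smul, add_zero, smul_eq_mul]
  rw [sub_eq_add_neg, ← mul_neg, ← Finset.sum_neg_distrib]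
  congr 2
  exact Finset.sum_congr rfl fun i _ => by ring

theorem stmt_7 (n m : ℕ) (hn : 1 ≤ n) (hm : 1 ≤ m)
    (x : Fin m → Fin n → ℝ) (hx : ∀ i, x i ≠ 0)
    (Sigstar : Matrix (Fin n) (Fin n) ℝ) (hSig : Sigstar.PosDef) :
    (Sigstar = ((n : ℝ) / m) •
        ∑ i : Fin m, (1 / (x i ⬝ᵥ (Sigstar⁻¹ *ᵥ x i))) • vecMulVec (x i) (x i)) ↔
    (∀ H : Matrix (Fin n) (Fin n) ℝ, H.IsSymm →
      deriv (fun t : ℝ =>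
        Real.log (Sigstar + t • H).det +
          ((n : ℝ) / m) * ∑ i : Fin m,
            Real.log (x i ⬝ᵥ ((Sigstar + t • H)⁻¹ *ᵥ x i))) 0 = 0) := by
  have hdet : IsUnit Sigstar.det := (isUnit_iff_isUnit_det _).mp hSig.isUnit
  have hsymm : Sigstarᵀ = Sigstar := by simpa using! hSig.isHermitian
  simp_rw [(hasDerivAt_tyler_objective hSig hx _ _).deriv]
  set M := ((n : ℝ) / m) •
    ∑ i : Fin m, (1 / (x i ⬝ᵥ (Sigstar⁻¹ *ᵥ x i))) • vecMulVec (x i) (x i) with hM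
  have hMsymm : Mᵀ = M := by
    simp [hM, transpose_sum, transpose_vecMulVec]
  refine ⟨fun h H _ => by simp [sub_eq_zero.mpr h], fun h => ?_⟩
  have hG : (Sigstar⁻¹ * (Sigstar - M) * Sigstar⁻¹)ᵀ = Sigstar⁻¹ * (Sigstar - M) * Sigstar⁻¹ := by
    simp [transpose_mul, transpose_nonsing_inv, hsymm, hMsymm, mul_assoc]
  have htr := h _ hG
  nth_rewrite 1 [← hG] at htr
  rw [← conjTranspose_eq_transpose_of_trivial, trace_conjTranspose_mul_self_eq_zero_iff] at htr
  have hcancel := congrArg (fun A => Sigstar * A * Sigstar) htr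
  simp only [mul_assoc, mul_nonsing_inv_cancel_left _ _ hdet, nonsing_inv_mul _ hdet, mul_one,
    mul_zero, zero_mul] at hcancel
  exact sub_eq_zero.mp hcancel
end

section
/- Let n ≥ 1 and let Σ be a real symmetric positive definite n×n matrix. Then the integral of x ↦ (xᵀ Σ⁻¹ x)^{-n/2} over the unit sphere S^{n-1} in ℝⁿ, with respect to the (n-1)-dimensional surface measure on the sphere, equals 2 π^{n/2} √(det Σ) / Γ(n/2). Equivalently, the angular central Gaussian density p(x; Σ) = (Γ(n/2) / (2 π^{n/2} √(det Σ))) (xᵀ Σ⁻¹ x)^{-n/2} integrates to 1 over the unit sphere. -/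
open MeasureTheory Real Matrix
open Set
open scoped MatrixOrder

theorem integral_eq_integral_toSphere {E F : Type*} [NormedAddCommGroup E] [NormedSpace ℝ E]
    [MeasurableSpace E] [BorelSpace E] [FiniteDimensional ℝ E] [Nontrivial E]
    [NormedAddCommGroup F] [NormedSpace ℝ F] (μ : Measure E) [μ.IsAddHaarMeasure]
    {f : E → F} (hf : Integrable f μ) :
    ∫ x, f x ∂μ = ∫ u : Metric.sphere (0 : E) 1, (∫ r in Ioi (0 : ℝ),
      r ^ (Module.finrank ℝ E - 1) • f (r • (u : E))) ∂μ.toSphere := by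
  have hmp := μ.measurePreserving_homeomorphUnitSphereProd
  have hme := (homeomorphUnitSphereProd E).measurableEmbedding
  have hcomp : (fun p : Metric.sphere (0 : E) 1 × Ioi (0 : ℝ) ↦ f (p.2.1 • p.1.1)) ∘
      homeomorphUnitSphereProd E = fun x : ({0}ᶜ : Set E) ↦ f x := by
    ext x
    have hx : ‖(x : E)‖ ≠ 0 := norm_ne_zero_iff.2 x.2
    simp [smul_smul, hx]
  have h_integrable : Integrable (fun p : Metric.sphere (0 : E) 1 × Ioi (0 : ℝ) ↦ f (p.2.1 • p.1.1))
      (μ.toSphere.prod (.volumeIoiPow (Module.finrank ℝ E - 1))) := by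
    rw [← hmp.integrable_comp_emb hme, hcomp]
    exact (integrableOn_iff_comap_subtypeVal (μ := μ) (f := f)
      (measurableSet_singleton (0 : E)).compl).1 hf.integrableOn
  calc
    ∫ x, f x ∂μ = ∫ x : ({0}ᶜ : Set E), f x ∂(μ.comap (↑)) := by
      rw [integral_subtype_comap (measurableSet_singleton _).compl f,
        restrict_compl_singleton]
    _ = ∫ p : Metric.sphere (0 : E) 1 × Ioi (0 : ℝ), f (p.2.1 • p.1.1)
        ∂(μ.toSphere.prod (.volumeIoiPow (Module.finrank ℝ E - 1))) := by
      rw [← hmp.integral_comp hme]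
      exact congrArg (fun g ↦ ∫ x, g x ∂(μ.comap ((↑) : ({0}ᶜ : Set E) → E))) hcomp.symm
    _ = _ := by
      rw [integral_prod _ h_integrable]
      refine integral_congr_ae (.of_forall fun u ↦ ?_)
      simp only [Measure.volumeIoiPow, ENNReal.ofReal]
      rw [integral_withDensity_eq_integral_smul,
        integral_subtype_comap measurableSet_Ioi
          fun r ↦ Real.toNNReal (r ^ (Module.finrank ℝ E - 1)) • f (r • (u : E)),
        setIntegral_congr_fun measurableSet_Ioi fun r hr ↦ ?_]
      · rw [NNReal.smul_def, Real.coe_toNNReal _ (pow_nonneg hr.out.le _)]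
      · exact (measurable_subtype_coe.pow_const _).real_toNNReal

theorem integral_exp_neg_dotProduct_mulVec {n : ℕ} {A : Matrix (Fin n) (Fin n) ℝ}
    (hA : A.PosDef) :
    ∫ x : EuclideanSpace ℝ (Fin n), rexp (-(x.ofLp ⬝ᵥ (A *ᵥ x.ofLp))) =
      π ^ ((n : ℝ) / 2) / √A.det := by
  obtain ⟨B, hB⟩ := CStarAlgebra.nonneg_iff_eq_star_mul_self.mp hA.posSemidef.nonneg
  rw [star_eq_conjTranspose, conjTranspose_eq_transpose_of_trivial] at hB
  have hdet : √A.det = |B.det| := by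
    rw [hB, det_mul, det_transpose, Real.sqrt_mul_self_eq_abs]
  have hB0 : B.det ≠ 0 := abs_pos.1 (hdet ▸ Real.sqrt_pos.2 hA.det_pos)
  have hL : LinearMap.det (toLpLin 2 2 B) = B.det := by
    rw [toLpLin_eq_toLin, LinearMap.det_toLin]
  have hq (x : EuclideanSpace ℝ (Fin n)) :
      x.ofLp ⬝ᵥ (A *ᵥ x.ofLp) = ‖toLpLin 2 2 B x‖ ^ 2 := by
    rw [EuclideanSpace.real_norm_sq_eq, hB, ← mulVec_mulVec, dotProduct_mulVec,
      vecMul_transpose]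
    simp [dotProduct, sq]
  have hL0 : LinearMap.det (toLpLin 2 2 B) ≠ 0 := hL ▸ hB0
  have hgauss := GaussianFourier.integral_rexp_neg_mul_sq_norm
    (V := EuclideanSpace ℝ (Fin n)) one_pos
  have hmap := integral_map (μ := (volume : Measure (EuclideanSpace ℝ (Fin n))))
    (φ := toLpLin 2 2 B) (f := fun y ↦ rexp (-1 * ‖y‖ ^ 2))
    (LinearMap.continuous_of_finiteDimensional _).aemeasurable (by fun_prop)
  rw [Measure.map_linearMap_addHaar_eq_smul_addHaar _ hL0, integral_smul_measure, hgauss, hL,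
    ENNReal.toReal_ofReal (abs_nonneg _)] at hmap
  simp only [hq, ← neg_one_mul (_ ^ 2 : ℝ), ← hmap, hdet, abs_inv]
  simp [div_eq_inv_mul]

theorem integral_Ioi_pow_mul_exp_neg_sq_mul {n : ℕ} (hn : 1 ≤ n) {b : ℝ} (hb : 0 < b) :
    ∫ r in Ioi (0 : ℝ), r ^ (n - 1) * rexp (-(r ^ 2 * b)) =
      b ^ (-(n : ℝ) / 2) * (Real.Gamma ((n : ℝ) / 2) / 2) := by
  have hn' : (1 : ℝ) ≤ n := mod_cast hn
  have h := integral_rpow_mul_exp_neg_mul_rpow (p := 2) (q := n - 1) two_pos (by linarith) hb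
  rw [sub_add_cancel, mul_assoc, one_div_mul_eq_div] at h
  rw [← h]
  refine integral_congr_ae (.of_forall fun r ↦ ?_)
  simp only
  rw [← Nat.cast_pred hn, rpow_natCast, rpow_two, neg_mul, mul_comm b]

theorem stmt_10 (n : ℕ) (hn : 1 ≤ n) (Sig : Matrix (Fin n) (Fin n) ℝ)
    (hSig : Sig.PosDef) :
    ∫ x : Metric.sphere (0 : EuclideanSpace ℝ (Fin n)) 1,
        (((x : EuclideanSpace ℝ (Fin n)) : Fin n → ℝ) ⬝ᵥ
            (Sig⁻¹ *ᵥ ((x : EuclideanSpace ℝ (Fin n)) : Fin n → ℝ))) ^ (-(n : ℝ) / 2)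
        ∂((volume : Measure (EuclideanSpace ℝ (Fin n))).toSphere) =
      2 * π ^ ((n : ℝ) / 2) * Real.sqrt Sig.det / Real.Gamma ((n : ℝ) / 2) := by
  have : NeZero n := ⟨by omega⟩
  have hA := hSig.inv
  have hdet : √(Sig⁻¹).det = (√Sig.det)⁻¹ := by
    rw [det_nonsing_inv, Ring.inverse_eq_inv', Real.sqrt_inv]
  have hsqrt : 0 < √Sig.det := Real.sqrt_pos.2 hSig.det_pos
  have hn' : (0 : ℝ) < n := mod_cast hn
  have hGamma : 0 < Real.Gamma ((n : ℝ) / 2) := Real.Gamma_pos_of_pos (by positivity)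
  have hgauss := integral_exp_neg_dotProduct_mulVec hA
  rw [hdet, div_inv_eq_mul] at hgauss
  have h_integrable := Integrable.of_integral_ne_zero (hgauss.trans_ne (by positivity))
  rw [integral_eq_integral_toSphere volume h_integrable, finrank_euclideanSpace_fin] at hgauss
  have hrad (u : Metric.sphere (0 : EuclideanSpace ℝ (Fin n)) 1) :
      ∫ r in Ioi (0 : ℝ), r ^ (n - 1) • rexp (-((r • u.1).ofLp ⬝ᵥ (Sig⁻¹ *ᵥ (r • u.1).ofLp))) =
        (u.1.ofLp ⬝ᵥ (Sig⁻¹ *ᵥ u.1.ofLp)) ^ (-(n : ℝ) / 2) * (Real.Gamma ((n : ℝ) / 2) / 2) := by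
    have hu : u.1.ofLp ≠ 0 := fun h ↦
      ne_zero_of_mem_unit_sphere u ((WithLp.ofLp_eq_zero 2).1 h)
    have hpos := hA.dotProduct_mulVec_pos hu
    rw [star_trivial] at hpos
    rw [← integral_Ioi_pow_mul_exp_neg_sq_mul hn hpos]
    simp only [WithLp.ofLp_smul, mulVec_smul, smul_dotProduct, dotProduct_smul, smul_eq_mul,
      ← mul_assoc, ← sq]
  simp only [hrad] at hgauss
  rw [integral_mul_const] at hgauss
  rw [eq_div_iff hGamma.ne']
  linarith
end

section
/- Let n ≥ 1, let x₁, …, x_m ∈ ℝⁿ be nonzero vectors, and define the Tyler objective f(Σ) = log det Σ + (n/m) ∑_{i=1}^m log(x_iᵀ Σ⁻¹ x_i) on real symmetric positive definite n×n matrices. Let Σ_k be symmetric positive definite and set Ŝ = (n/m) ∑_{i=1}^m (1 / (x_iᵀ Σ_k⁻¹ x_i)) x_i x_iᵀ. If Σ' is any symmetric positive definite matrix with log det Σ' + Tr((Σ')⁻¹ Ŝ) ≤ log det Σ_k + Tr(Σ_k⁻¹ Ŝ), then f(Σ') ≤ f(Σ_k). In particular, each EM iteration does not increase the Tyler objective.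 -/
open Matrix

theorem trace_mul_smul_sum_smul_vecMulVec {ι κ : Type*} [Fintype ι] [Fintype κ]
    (A : Matrix ι ι ℝ) (c : ℝ) (w : κ → ℝ) (x : κ → ι → ℝ) :
    (A * (c • ∑ i, w i • vecMulVec (x i) (x i))).trace =
      c * ∑ i, w i * (x i ⬝ᵥ (A *ᵥ x i)) := by
  simp only [mul_smul_comm, Finset.mul_sum, trace_smul, trace_sum, smul_eq_mul,
    mul_vecMulVec, trace_vecMulVec, dotProduct_comm]

theorem Real.log_sub_log_le_inv_mul_sub {a b : ℝ} (ha : 0 < a) (hb : 0 < b) :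
    Real.log b - Real.log a ≤ 1 / a * b - 1 / a * a := by
  have h := Real.log_le_sub_one_of_pos (div_pos hb ha)
  rw [Real.log_div hb.ne' ha.ne'] at h
  rwa [one_div_mul_cancel ha.ne', one_div_mul_eq_div]

theorem stmt_11 (n m : ℕ) (hn : 1 ≤ n) (hm : 1 ≤ m)
    (x : Fin m → Fin n → ℝ) (hx : ∀ i, x i ≠ 0)
    (f : Matrix (Fin n) (Fin n) ℝ → ℝ)
    (hf : ∀ Sig, f Sig = Real.log Sig.det +
      ((n : ℝ) / m) * ∑ i : Fin m, Real.log (x i ⬝ᵥ (Sig⁻¹ *ᵥ x i)))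
    (Sigk : Matrix (Fin n) (Fin n) ℝ) (hSigk : Sigk.PosDef)
    (Shat : Matrix (Fin n) (Fin n) ℝ)
    (hShat : Shat = ((n : ℝ) / m) •
      ∑ i : Fin m, (1 / (x i ⬝ᵥ (Sigk⁻¹ *ᵥ x i))) • vecMulVec (x i) (x i))
    (Sig' : Matrix (Fin n) (Fin n) ℝ) (hSig' : Sig'.PosDef)
    (hdec : Real.log Sig'.det + (Sig'⁻¹ * Shat).trace ≤
      Real.log Sigk.det + (Sigk⁻¹ * Shat).trace) :
    f Sig' ≤ f Sigk := by
  have hpos {A : Matrix (Fin n) (Fin n) ℝ} (hA : A.PosDef) (i : Fin m) :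
      0 < x i ⬝ᵥ (A⁻¹ *ᵥ x i) := by
    simpa using hA.inv.dotProduct_mulVec_pos (hx i)
  rw [hShat, trace_mul_smul_sum_smul_vecMulVec, trace_mul_smul_sum_smul_vecMulVec] at hdec
  have hsum := Finset.sum_le_sum fun i (_ : i ∈ Finset.univ) =>
    Real.log_sub_log_le_inv_mul_sub (hpos hSigk i) (hpos hSig' i)
  rw [Finset.sum_sub_distrib, Finset.sum_sub_distrib] at hsum
  have hmul := mul_le_mul_of_nonneg_left hsum (by positivity : (0 : ℝ) ≤ (n : ℝ) / m)
  rw [mul_sub, mul_sub] at hmul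
  rw [hf, hf]
  linarith
end
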